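/- For all natural numbers K and i, the rational-number identity Σ_{j=0}^{min(i,K)} (−1)^j · binom(K,j) · (binom(2j,j)/(j+1)) · binom(2(K−j), i−j) = binom(K, ⌈i/2⌉) · binom(K, ⌊i/2⌋) holds, where ⌈i/2⌉ and ⌊i/2⌋ denote the ceiling and floor of i/2 (i.e. (i+1) div 2 and i div 2 in natural-number division). -/

import Mathlib

open Finset

open Polynomial in
/-- The product `((1 - r X) (X - r)) ^ K` expanded after regrouping its base as
`X (1 + r) ^ 2 - r (1 + X) ^ 2`; coefficient of `X ^ (K + e)`. -/
lemma coeff_regrouped_pow {R : Type*} [CommRing R] (r : R) (K e : ℕ) :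
    (((1 - C r * X) * (X - C r)) ^ K : R[X]).coeff (K + e) =
      ∑ j ∈ range (K + 1),
        (-r) ^ j * (1 + r) ^ (2 * (K - j)) * K.choose j * (2 * j).choose (j + e) := by
  have base : ((1 - C r * X) * (X - C r) : R[X]) =
      C (-r) * (1 + X) ^ 2 + C ((1 + r) ^ 2) * X := by
    simp only [map_neg, map_pow, map_add, map_one]
    ring
  rw [base, add_pow, finsetSum_coeff]
  refine sum_congr rfl fun j hj => ?_
  have hj : j ≤ K := by simpa [Nat.lt_succ_iff] using hj
  have term : ((C (-r) * (1 + X) ^ 2) ^ j * (C ((1 + r) ^ 2) * X) ^ (K - j) * (K.choose j : R[X])) =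
      C ((-r) ^ j * (1 + r) ^ (2 * (K - j)) * K.choose j) *
        ((1 + X) ^ (2 * j) * X ^ (K - j)) := by
    simp only [map_neg, map_pow, map_mul, map_add, map_one, map_natCast, mul_pow, pow_mul]
    ring
  rw [term, coeff_C_mul, show K + e = (j + e) + (K - j) by omega, coeff_mul_X_pow,
    coeff_one_add_X_pow]

open Polynomial in
lemma coeff_factored_pow {R : Type*} [CommRing R] (r : R) (K e : ℕ) :
    (((1 - C r * X) * (X - C r)) ^ K : R[X]).coeff (K + e) =
      ∑ a ∈ range (K + 1),
        (-r) ^ a * K.choose a * ((-r) ^ (K - (K + e - a)) * K.choose (K + e - a)) := by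
  rw [mul_pow, sub_eq_neg_add, add_pow, sum_mul, finsetSum_coeff]
  refine sum_congr rfl fun a ha => ?_
  have ha : a ≤ K := by simpa [Nat.lt_succ_iff] using ha
  have term : (-(C r * X)) ^ a * 1 ^ (K - a) * (K.choose a : R[X]) * (X - C r) ^ K =
      C ((-r) ^ a * K.choose a) * ((X - C r) ^ K * X ^ a) := by
    rw [← neg_mul, mul_pow]
    simp only [map_neg, map_pow, map_mul, map_natCast, one_pow]
    ring
  conv_lhs => rw [term, coeff_C_mul, show K + e = (K + e - a) + a by omega, coeff_mul_X_pow,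
    sub_eq_add_neg, ← C_neg, coeff_X_add_C_pow]

/-- The generating function, in `r`, of the symmetric Dyck path identity. -/
lemma sum_catalan_mul_pow {R : Type*} [CommRing R] (r : R) (K : ℕ) :
    ∑ j ∈ range (K + 1), (-r) ^ j * (1 + r) ^ (2 * (K - j)) * K.choose j *
        (((2 * j).choose j : R) - (2 * j).choose (j + 1)) =
      ∑ a ∈ range (K + 1), (K.choose a : R) * K.choose a * r ^ (2 * a) +
        ∑ a ∈ range (K + 1), (K.choose (a + 1) : R) * K.choose a * r ^ (2 * a + 1) := by
  have h0 := (coeff_regrouped_pow r K 0).symm.trans (coeff_factored_pow r K 0)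
  have h1 := (coeff_regrouped_pow r K 1).symm.trans (coeff_factored_pow r K 1)
  simp only [mul_sub, sum_sub_distrib]
  simp only [add_zero] at h0
  rw [h0, h1, sub_eq_add_neg]
  congr 1
  · refine sum_congr rfl fun a ha => ?_
    have ha : a ≤ K := by simpa [Nat.lt_succ_iff] using ha
    rw [Nat.sub_sub_self ha, Nat.choose_symm ha, pow_mul, ← neg_sq r, ← pow_mul]
    ring
  · rw [sum_range_succ', sum_range_succ _ K]
    simp only [Nat.sub_zero, Nat.choose_succ_self, Nat.cast_zero, mul_zero, zero_mul, add_zero,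
      ← sum_neg_distrib]
    refine sum_congr rfl fun a ha => ?_
    have ha : a ≤ K := (mem_range.1 ha).le
    rw [Nat.add_sub_add_right, Nat.sub_sub_self ha, Nat.choose_symm ha, pow_succ r, pow_mul,
      ← neg_sq r, ← pow_mul]
    ring

lemma choose_sub_choose_succ_eq_div (j : ℕ) :
    ((2 * j).choose j : ℚ) - (2 * j).choose (j + 1) = (2 * j).choose j / ((j : ℚ) + 1) := by
  have h := Nat.choose_succ_right_eq (2 * j) j
  rw [show 2 * j - j = j by omega] at h
  have h : ((2 * j).choose (j + 1) : ℚ) * (j + 1) = (2 * j).choose j * j := by exact_mod_cast h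
  rw [eq_div_iff (by positivity)]
  linarith

theorem symmetric_dyck_paths_identity (K i : ℕ) :
    ∑ j ∈ Finset.range (min i K + 1),
        (-1 : ℚ) ^ j * (K.choose j : ℚ) * (((2 * j).choose j : ℚ) / ((j : ℚ) + 1)) *
          ((2 * (K - j)).choose (i - j) : ℚ) =
      (K.choose ((i + 1) / 2) : ℚ) * (K.choose (i / 2) : ℚ) := by
  have h := congrArg (fun p : Polynomial ℚ => p.coeff i)
    (sum_catalan_mul_pow (Polynomial.X : Polynomial ℚ) K)
  simp only [Polynomial.coeff_add, Polynomial.finsetSum_coeff] at h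
  have lhs (j : ℕ) : ((-Polynomial.X : Polynomial ℚ) ^ j * (1 + Polynomial.X) ^ (2 * (K - j)) * (K.choose j : Polynomial ℚ) *
        (((2 * j).choose j : Polynomial ℚ) - ((2 * j).choose (j + 1) : Polynomial ℚ))).coeff i =
      if j ≤ i then (-1 : ℚ) ^ j * (K.choose j : ℚ) * (((2 * j).choose j : ℚ) / ((j : ℚ) + 1)) *
          ((2 * (K - j)).choose (i - j) : ℚ) else 0 := by
    rw [← choose_sub_choose_succ_eq_div]
    have term : ((-Polynomial.X : Polynomial ℚ) ^ j * (1 + Polynomial.X) ^ (2 * (K - j)) * (K.choose j : Polynomial ℚ) *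
        (((2 * j).choose j : Polynomial ℚ) - ((2 * j).choose (j + 1) : Polynomial ℚ))) =
        Polynomial.C ((-1 : ℚ) ^ j * (K.choose j : ℚ) *
          (((2 * j).choose j : ℚ) - (2 * j).choose (j + 1))) *
          ((1 + Polynomial.X) ^ (2 * (K - j)) * Polynomial.X ^ j) := by
      rw [neg_pow]
      simp only [map_neg, map_pow, map_mul, map_sub, map_one, map_natCast]
      ring
    rw [term, Polynomial.coeff_C_mul, Polynomial.coeff_mul_X_pow', Polynomial.coeff_one_add_X_pow,
      mul_ite, mul_zero]
  have rhs (m n k : ℕ) : ((m : Polynomial ℚ) * (n : Polynomial ℚ) * Polynomial.X ^ k).coeff i =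
      if i = k then (m : ℚ) * n else 0 := by
    rw [← Nat.cast_mul, ← Polynomial.C_eq_natCast, Polynomial.coeff_C_mul_X_pow, Nat.cast_mul]
  simp only [lhs, rhs] at h
  rw [← sum_filter] at h
  have index : (range (K + 1)).filter (· ≤ i) = range (min i K + 1) := by
    ext j
    simp only [mem_filter, mem_range]
    omega
  rw [index] at h
  rw [h]
  obtain ⟨a, rfl | rfl⟩ := i.even_or_odd'
  · rw [show (2 * a + 1) / 2 = a by omega, show 2 * a / 2 = a by omega,
      sum_eq_single a (by intros; rw [if_neg (by omega)]), if_pos rfl,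
      sum_eq_zero (by intros; rw [if_neg (by omega)]), add_zero]
    intro ha
    simp [Nat.choose_eq_zero_of_lt (show K < a by simpa using ha)]
  · rw [show (2 * a + 1 + 1) / 2 = a + 1 by omega, show (2 * a + 1) / 2 = a by omega,
      sum_eq_zero (s := range (K + 1)) (by intros; rw [if_neg (by omega)]), zero_add,
      sum_eq_single a (by intros; rw [if_neg (by omega)]), if_pos rfl]
    intro ha
    simp [Nat.choose_eq_zero_of_lt (show K < a by simpa using ha)]
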